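/- Given a relational schema S = (R1,…,Rm), a finite set Γ of TGDs over S, and a finite initial database instance I, there exist a signature Σ, a term rewriting system R over Σ, and a ground term t such that ξ(EqSat(R, t)) = SklCh(Γ, I), where ξ maps an E-graph to the database instance consisting of all terms of the form R(c1,…,ck) (R a relation symbol of S) in the language represented by the E-graph. Moreover, the Skolem chase on (Γ, I) terminates if and only if equality saturation on (R, t) terminates. -/

import Mathlib

set_option autoImplicit false

/-! ## Terms over a signature -/

inductive Tm (F : Type) (ar : F → ℕ) (V : Type) : Type where
  | var : V → Tm F ar V
  | node : (f : F) → (Fin (ar f) → Tm F ar V) → Tm F ar V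

namespace Tm

variable {F : Type} {ar : F → ℕ} {V W : Type}

/-- Apply a renaming of variables/states. -/
def map (σ : V → W) : Tm F ar V → Tm F ar W
  | .var v => .var (σ v)
  | .node f ts => .node f fun i => (ts i).map σ

/-- Apply a substitution. -/
def subst (σ : V → Tm F ar W) : Tm F ar V → Tm F ar W
  | .var v => σ v
  | .node f ts => .node f fun i => (ts i).subst σ

/-- The set of variables occurring in a pattern. -/
def vars : Tm F ar V → Set V
  | .var v => {v}
  | .node _ ts => ⋃ i, (ts i).vars

end Tm

/-- Ground terms: terms with no variables. -/
abbrev GTm (F : Type) (ar : F → ℕ) : Type := Tm F ar Empty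

/-- A ground term viewed as a term over `Σ ∪ V`. -/
def GTm.embed {F : Type} {ar : F → ℕ} {V : Type} (t : GTm F ar) : Tm F ar V :=
  Tm.map (fun e => e.elim) t

/-- The (reflexive) subterm relation. -/
inductive Subterm {F : Type} {ar : F → ℕ} {V : Type} : Tm F ar V → Tm F ar V → Prop where
  | refl (t : Tm F ar V) : Subterm t t
  | node {u : Tm F ar V} {f : F} {ts : Fin (ar f) → Tm F ar V} (i : Fin (ar f)) :
      Subterm u (ts i) → Subterm u (.node f ts)

theorem Subterm.trans' {F : Type} {ar : F → ℕ} {V : Type} {a b c : Tm F ar V}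
    (h1 : Subterm a b) (h2 : Subterm b c) : Subterm a c := by
  induction h2 with
  | refl => exact h1
  | node i _ ih => exact Subterm.node i ih

theorem Subterm.child {F : Type} {ar : F → ℕ} {V : Type} {f : F}
    {ts : Fin (ar f) → Tm F ar V} {c : Tm F ar V} (i : Fin (ar f))
    (h : Subterm (.node f ts) c) : Subterm (ts i) c :=
  Subterm.trans' (Subterm.node i (Subterm.refl _)) h

/-! ## Tree automata and E-graphs -/

/-- A (bottom-up, possibly infinite) tree automaton: a set of states together with
transitions `f(q₁,…,qₖ) → q`. -/
structure Automaton (F : Type) (ar : F → ℕ) : Type 1 where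
  Q : Type
  trans : (f : F) → Set ((Fin (ar f) → Q) × Q)

/-- `Accepts A t q` formalizes `t →*_A q`: the term `t ∈ T(Σ ∪ Q)` rewrites to the state `q`. -/
inductive Accepts {F : Type} {ar : F → ℕ} (A : Automaton F ar) : Tm F ar A.Q → A.Q → Prop where
  | var (q : A.Q) : Accepts A (.var q) q
  | node {f : F} {ts : Fin (ar f) → Tm F ar A.Q} {qs : Fin (ar f) → A.Q} {q : A.Q} :
      (∀ i, Accepts A (ts i) (qs i)) → (qs, q) ∈ A.trans f → Accepts A (.node f ts) q

/-- A ground term `t ∈ T(Σ)` is accepted by the state `q`, i.e. `t →*_A q`. -/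
def Automaton.AcceptsG {F : Type} {ar : F → ℕ} (A : Automaton F ar) (t : GTm F ar) (q : A.Q) : Prop :=
  Accepts A (GTm.embed t) q

/-- Deterministic: every ground term is accepted by at most one state. -/
def Automaton.Deterministic {F : Type} {ar : F → ℕ} (A : Automaton F ar) : Prop :=
  ∀ (t : GTm F ar) (q1 q2 : A.Q), A.AcceptsG t q1 → A.AcceptsG t q2 → q1 = q2

/-- Reachable: every state accepts some ground term. -/
def Automaton.ReachableA {F : Type} {ar : F → ℕ} (A : Automaton F ar) : Prop :=
  ∀ q : A.Q, ∃ t : GTm F ar, A.AcceptsG t q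

/-- An E-graph is a deterministic and reachable tree automaton. -/
structure EGraph (F : Type) (ar : F → ℕ) extends Automaton F ar where
  det : toAutomaton.Deterministic
  reach : toAutomaton.ReachableA

/-- A homomorphism of tree automata: maps states to states, preserving all transitions. -/
structure AHom {F : Type} {ar : F → ℕ} (A B : Automaton F ar) : Type where
  toFun : A.Q → B.Q
  map_trans : ∀ (f : F) (qs : Fin (ar f) → A.Q) (q : A.Q),
    (qs, q) ∈ A.trans f → (fun i => toFun (qs i), toFun q) ∈ B.trans f

/-- `A ⊑ B` : there exists a homomorphism from `A` to `B`. -/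
def ALe {F : Type} {ar : F → ℕ} (A B : Automaton F ar) : Prop := Nonempty (AHom A B)

def EGraph.Le {F : Type} {ar : F → ℕ} (G H : EGraph F ar) : Prop :=
  ALe G.toAutomaton H.toAutomaton

/-- Isomorphism of E-graphs: mutually inverse homomorphisms. -/
def EGraph.Iso {F : Type} {ar : F → ℕ} (G H : EGraph F ar) : Prop :=
  ∃ (h : AHom G.toAutomaton H.toAutomaton) (h' : AHom H.toAutomaton G.toAutomaton),
    (∀ q, h'.toFun (h.toFun q) = q) ∧ (∀ q, h.toFun (h'.toFun q) = q)

/-- The partial congruence relation `≈_G` induced by an E-graph: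
two ground terms are related iff some state accepts both. -/
def EGraph.eqv {F : Type} {ar : F → ℕ} (G : EGraph F ar) (t1 t2 : GTm F ar) : Prop :=
  ∃ q : G.Q, G.toAutomaton.AcceptsG t1 q ∧ G.toAutomaton.AcceptsG t2 q

/-- A finite E-graph: finitely many states and transitions. -/
def EGraph.IsFinite {F : Type} {ar : F → ℕ} (G : EGraph F ar) : Prop :=
  Finite G.Q ∧ ∀ f : F, (G.trans f).Finite

/-! ## Partial congruence relations -/

/-- A partial congruence relation (PCR) on ground terms: a symmetric, transitive,
congruent and reachable binary relation. -/
structure IsPCR {F : Type} {ar : F → ℕ} (E : GTm F ar → GTm F ar → Prop) : Prop where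
  symm : ∀ {t1 t2 : GTm F ar}, E t1 t2 → E t2 t1
  trans : ∀ {t1 t2 t3 : GTm F ar}, E t1 t2 → E t2 t3 → E t1 t3
  congruent : ∀ (f : F) (s t : Fin (ar f) → GTm F ar),
    (∀ i, E (s i) (t i)) → E (.node f s) (.node f s) → E (.node f s) (.node f t)
  reachable : ∀ (f : F) (s : Fin (ar f) → GTm F ar),
    E (.node f s) (.node f s) → ∀ i, E (s i) (s i)

/-- The join of two PCRs: the smallest PCR containing both. -/
def joinPCR {F : Type} {ar : F → ℕ} (E1 E2 : GTm F ar → GTm F ar → Prop)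
    (a b : GTm F ar) : Prop :=
  ∀ E : GTm F ar → GTm F ar → Prop, IsPCR E →
    (∀ x y, E1 x y → E x y) → (∀ x y, E2 x y → E x y) → E a b

/-! ## Term rewriting systems -/

/-- A term rewriting system: a finite set of rules `lhs → rhs` between patterns
(terms with variables drawn from `ℕ`), with `Var(rhs) ⊆ Var(lhs)`. -/
structure TRS (F : Type) (ar : F → ℕ) where
  rules : Set (Tm F ar ℕ × Tm F ar ℕ)
  finite : rules.Finite
  var_cond : ∀ r ∈ rules, Tm.vars r.2 ⊆ Tm.vars r.1

/-- The ground rewrite relation `→_R` determined by a TRS. -/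
inductive RWStep {F : Type} {ar : F → ℕ} (R : TRS F ar) : GTm F ar → GTm F ar → Prop where
  | rule {l r : Tm F ar ℕ} (h : (l, r) ∈ R.rules) (σ : ℕ → GTm F ar) :
      RWStep R (l.subst σ) (r.subst σ)
  | congr {f : F} {ts : Fin (ar f) → GTm F ar} {i : Fin (ar f)} {u : GTm F ar} :
      RWStep R (ts i) u → RWStep R (.node f ts) (.node f (Function.update ts i u))

/-- `≈_R` : the reflexive-symmetric-transitive closure of `→_R`. -/
def TRSEqv {F : Type} {ar : F → ℕ} (R : TRS F ar) : GTm F ar → GTm F ar → Prop :=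
  Relation.ReflTransGen fun a b => RWStep R a b ∨ RWStep R b a

/-! ## E-matching, insertion and congruence closure -/

/-- An e-match of a rule in an E-graph: a substitution `σ` into E-classes and a root
E-class `c` with `lhs[σ] →*_G c`. -/
structure EMatch {F : Type} {ar : F → ℕ} (R : TRS F ar) (G : EGraph F ar) : Type where
  lhs : Tm F ar ℕ
  rhs : Tm F ar ℕ
  mem : (lhs, rhs) ∈ R.rules
  sub : ℕ → G.Q
  root : G.Q
  acc : Accepts G.toAutomaton (Tm.map sub lhs) root

/-- Fresh states of the flattenings added by the match/apply operator: one state per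
(match, subterm of the instantiated right-hand side). -/
def MExtra {F : Type} {ar : F → ℕ} (R : TRS F ar) (G : EGraph F ar) : Type :=
  { p : EMatch R G × Tm F ar G.Q // Subterm p.2 (Tm.map p.1.sub p.1.rhs) }

open Classical in
/-- The state of the flattening `FL(rhs[σ] →* c)` associated to a subterm `u` of `rhs[σ]`:
states at the leaves are kept, the root is mapped to `c = root`, and all other subterms
get a fresh state. -/
noncomputable def stateOf {F : Type} {ar : F → ℕ} (R : TRS F ar) (G : EGraph F ar)
    (m : EMatch R G) :
    (u : Tm F ar G.Q) → Subterm u (Tm.map m.sub m.rhs) → G.Q ⊕ MExtra R G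
  | .var q, _ => Sum.inl q
  | .node f ts, h =>
      if Tm.node f ts = Tm.map m.sub m.rhs then Sum.inl m.root
      else Sum.inr ⟨(m, Tm.node f ts), h⟩

/-- The match/apply operator `T_R`: the (possibly non-deterministic) tree automaton
obtained from `G` by inserting the flattening `FL(rhs[σ] →* c)` for every e-match. -/
noncomputable def TRaut {F : Type} {ar : F → ℕ} (R : TRS F ar) (G : EGraph F ar) :
    Automaton F ar where
  Q := G.Q ⊕ MExtra R G
  trans f := { p |
    (∃ (qs : Fin (ar f) → G.Q) (q : G.Q), (qs, q) ∈ G.trans f ∧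
      p = (fun i => Sum.inl (qs i), Sum.inl q)) ∨
    (∃ (m : EMatch R G) (ts : Fin (ar f) → Tm F ar G.Q)
        (h : Subterm (.node f ts) (Tm.map m.sub m.rhs)),
      p = (fun i => stateOf R G m (ts i) (Subterm.child i h),
           stateOf R G m (.node f ts) h)) }

/-- `G` is the congruence closure (rebuilding) of the automaton `A`: the ⊑-least E-graph
above `A`. -/
def IsCC {F : Type} {ar : F → ℕ} (A : Automaton F ar) (G : EGraph F ar) : Prop :=
  ALe A G.toAutomaton ∧ ∀ H : EGraph F ar, ALe A H.toAutomaton → EGraph.Le G H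

/-- `H` is (up to isomorphism) the result of the immediate consequence operator
`ICO_R = CC ∘ T_R` applied to `G`. -/
def IsICO {F : Type} {ar : F → ℕ} (R : TRS F ar) (G H : EGraph F ar) : Prop :=
  IsCC (TRaut R G) H

/-- `S` is the sequence of iterates `S i = ICO_R^(i)(G)`. -/
def IterSeq {F : Type} {ar : F → ℕ} (R : TRS F ar) (G : EGraph F ar)
    (S : ℕ → EGraph F ar) : Prop :=
  S 0 = G ∧ ∀ i, IsICO R (S i) (S (i + 1))

/-- `H` is a least upper bound of the sequence `S` of E-graphs. -/
def IsLUBseq {F : Type} {ar : F → ℕ} (S : ℕ → EGraph F ar) (H : EGraph F ar) : Prop :=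
  (∀ i, (S i).Le H) ∧ ∀ H' : EGraph F ar, (∀ i, (S i).Le H') → H.Le H'

/-- `H` is a least upper bound of the family `Gs` of E-graphs. -/
def IsLUBfam {F : Type} {ar : F → ℕ} {I : Type} (Gs : I → EGraph F ar)
    (H : EGraph F ar) : Prop :=
  (∀ i, (Gs i).Le H) ∧ ∀ H' : EGraph F ar, (∀ i, (Gs i).Le H') → H.Le H'

/-- `H = EqSat(R, G) = ⊔_{i ≥ 0} ICO_R^(i)(G)`. -/
def IsEqSat {F : Type} {ar : F → ℕ} (R : TRS F ar) (G H : EGraph F ar) : Prop :=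
  ∃ S : ℕ → EGraph F ar, IterSeq R G S ∧ IsLUBseq S H

/-- `H` is a model of the TRS `R`. -/
def ModelTRS {F : Type} {ar : F → ℕ} (R : TRS F ar) (H : EGraph F ar) : Prop :=
  ∀ r ∈ R.rules, ∀ (σ : ℕ → H.Q) (c : H.Q),
    Accepts H.toAutomaton (Tm.map σ r.1) c → Accepts H.toAutomaton (Tm.map σ r.2) c

/-- `H` is a model of the pair `(R, G)`. -/
def IsModelOf {F : Type} {ar : F → ℕ} (R : TRS F ar) (G H : EGraph F ar) : Prop :=
  G.Le H ∧ ModelTRS R H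

/-- `H` is a universal model of the pair `(R, G)`. -/
def IsUniversalModel {F : Type} {ar : F → ℕ} (R : TRS F ar) (G H : EGraph F ar) : Prop :=
  IsModelOf R G H ∧ ∀ H' : EGraph F ar, IsModelOf R G H' → H.Le H'

/-- `G` is (up to isomorphism) the flattening `FL(t →* c)` of a ground term `t`:
the ⊑-least E-graph representing `t`. -/
def IsTermEG {F : Type} {ar : F → ℕ} (t : GTm F ar) (G : EGraph F ar) : Prop :=
  (∃ c, G.toAutomaton.AcceptsG t c) ∧
  ∀ H : EGraph F ar, (∃ c, H.toAutomaton.AcceptsG t c) → G.Le H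

/-- Equality saturation terminates on `(R, G)`: the sequence of iterates
`ICO_R^(i)(G)` is eventually constant up to isomorphism. -/
def EqSatTerminates {F : Type} {ar : F → ℕ} (R : TRS F ar) (G : EGraph F ar) : Prop :=
  ∃ S : ℕ → EGraph F ar, IterSeq R G S ∧ ∃ n, ∀ m, n ≤ m → (S m).Iso (S n)

/-! ## Relational schemas, TGDs and the Skolem chase -/

/-- An atom `R(x₁,…,xₖ)` over a schema `(RS, rar)` with entries from `D`. -/
abbrev DBAtom (RS : Type) (rar : RS → ℕ) (D : Type) : Type := Σ Rn : RS, Fin (rar Rn) → D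

/-- A database instance: a (possibly infinite) set of atoms. -/
abbrev DBInst (RS : Type) (rar : RS → ℕ) (D : Type) : Type := Set (DBAtom RS rar D)

/-- A tuple-generating dependency `λ(x,y) → ∃z. ρ(x,z)`.  Variables are natural numbers;
in the head, `Sum.inl v` is a universally quantified (frontier) variable and `Sum.inr z`
is an existentially quantified variable.  Safety: every universal variable of the head
occurs in the body. -/
structure TGDep (RS : Type) (rar : RS → ℕ) where
  body : List (DBAtom RS rar ℕ)
  head : List (DBAtom RS rar (ℕ ⊕ ℕ))
  safe : ∀ v : ℕ, (∃ a ∈ head, ∃ i, a.2 i = Sum.inl v) → ∃ b ∈ body, ∃ j, b.2 j = v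

/-- The frontier variables of a TGD: universal variables occurring in the head, which
become the arguments of the Skolem functions. -/
def TGDep.IsFrontier {RS : Type} {rar : RS → ℕ} (d : TGDep RS rar) (v : ℕ) : Prop :=
  ∃ a ∈ d.head, ∃ i, a.2 i = Sum.inl v

/-- Skolem terms: the domain of the Skolem chase, generated by the constants `C` and one
Skolem function `f^d_z` for each TGD `d` and existential variable `z`, whose arguments
are indexed by the frontier variables of `d`. -/
inductive SkT (RS : Type) (rar : RS → ℕ) (C : Type) : Type where
  | const : C → SkT RS rar C
  | sk : (d : TGDep RS rar) → ℕ → ({v : ℕ // d.IsFrontier v} → SkT RS rar C) → SkT RS rar C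

/-- Instantiation of a head variable under the Skolemization of `d` and valuation `h`. -/
def skSub {RS : Type} {rar : RS → ℕ} {C : Type} (d : TGDep RS rar)
    (h : ℕ → SkT RS rar C) : ℕ ⊕ ℕ → SkT RS rar C
  | Sum.inl v => h v
  | Sum.inr z => SkT.sk d z fun v => h v.1

/-- The immediate consequence operator of the Skolemized TGDs. -/
def skStep {RS : Type} {rar : RS → ℕ} {C : Type} (Γ : Set (TGDep RS rar))
    (I : DBInst RS rar (SkT RS rar C)) : DBInst RS rar (SkT RS rar C) :=
  I ∪ { a | ∃ d ∈ Γ, ∃ h : ℕ → SkT RS rar C,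
    (∀ b ∈ d.body, (⟨b.1, fun i => h (b.2 i)⟩ : DBAtom RS rar (SkT RS rar C)) ∈ I) ∧
    ∃ ha ∈ d.head, a = (⟨ha.1, fun i => skSub d h (ha.2 i)⟩ : DBAtom RS rar (SkT RS rar C)) }

/-- The initial database embedded into the Skolem-term domain. -/
def skBase {RS : Type} {rar : RS → ℕ} {C : Type} (I : DBInst RS rar C) :
    DBInst RS rar (SkT RS rar C) :=
  (fun a : DBAtom RS rar C =>
    (⟨a.1, fun i => SkT.const (a.2 i)⟩ : DBAtom RS rar (SkT RS rar C))) '' I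

/-- The result of the Skolem chase: the least fixpoint of the immediate consequence
operator of the Skolemized TGDs. -/
def SklCh {RS : Type} {rar : RS → ℕ} {C : Type} (Γ : Set (TGDep RS rar))
    (I : DBInst RS rar C) : DBInst RS rar (SkT RS rar C) :=
  ⋃ n : ℕ, (skStep Γ)^[n] (skBase I)

/-- The Skolem chase terminates: its fixpoint is reached in finitely many steps. -/
def SklChTerminates {RS : Type} {rar : RS → ℕ} {C : Type} (Γ : Set (TGDep RS rar))
    (I : DBInst RS rar C) : Prop :=
  ∃ n : ℕ, (skStep Γ)^[n + 1] (skBase I) = (skStep Γ)^[n] (skBase I)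

/-! ## Acceptance, homomorphisms and the match/apply operator -/

namespace EqSatReduction

section Generic

variable {F : Type} {ar : F → ℕ}

theorem accepts_var_iff {A : Automaton F ar} {p q : A.Q} : Accepts A (.var p) q ↔ p = q := by
  constructor
  · intro h
    cases h
    rfl
  · rintro rfl
    exact .var p

theorem accepts_node_iff {A : Automaton F ar} {f : F} {ts : Fin (ar f) → Tm F ar A.Q} {q : A.Q} :
    Accepts A (.node f ts) q ↔
      ∃ qs : Fin (ar f) → A.Q, (∀ i, Accepts A (ts i) (qs i)) ∧ (qs, q) ∈ A.trans f := by
  constructor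
  · intro h
    cases h with
    | node h1 h2 => exact ⟨_, h1, h2⟩
  · rintro ⟨qs, h1, h2⟩
    exact .node h1 h2

theorem acceptsG_node_iff {A : Automaton F ar} {f : F} {ts : Fin (ar f) → GTm F ar} {q : A.Q} :
    A.AcceptsG (.node f ts) q ↔
      ∃ qs : Fin (ar f) → A.Q, (∀ i, A.AcceptsG (ts i) (qs i)) ∧ (qs, q) ∈ A.trans f :=
  accepts_node_iff

theorem map_id {V : Type} (t : Tm F ar V) : t.map id = t := by
  induction t with
  | var v => rfl
  | node f ts ih => simp only [Tm.map, ih]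

theorem map_map {U V W : Type} (g : V → W) (f : U → V) (t : Tm F ar U) :
    (t.map f).map g = t.map (g ∘ f) := by
  induction t with
  | var v => rfl
  | node f ts ih => simp only [Tm.map, ih]

theorem map_embed {V W : Type} (g : V → W) (t : GTm F ar) :
    Tm.map g (GTm.embed t) = GTm.embed t := by
  unfold GTm.embed
  rw [map_map]
  congr 1
  funext e
  exact e.elim

theorem vars_embed {V : Type} (t : GTm F ar) : Tm.vars (GTm.embed t : Tm F ar V) = ∅ := by
  induction t with
  | var v => exact v.elim
  | node f ts ih =>
    have : Tm.vars (GTm.embed (.node f ts) : Tm F ar V) =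
        ⋃ i, Tm.vars (GTm.embed (ts i) : Tm F ar V) := rfl
    rw [this]
    simp only [ih, Set.iUnion_empty]

theorem accepts_map {A B : Automaton F ar} (g : AHom A B) {t : Tm F ar A.Q} {q : A.Q}
    (h : Accepts A t q) : Accepts B (t.map g.toFun) (g.toFun q) := by
  induction h with
  | var q => exact .var _
  | node _ h2 ih => exact .node ih (g.map_trans _ _ _ h2)

theorem acceptsG_map {A B : Automaton F ar} (g : AHom A B) {t : GTm F ar} {q : A.Q}
    (h : A.AcceptsG t q) : B.AcceptsG t (g.toFun q) := by
  have := accepts_map g h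
  rwa [map_embed] at this

theorem acceptsG_subst {A : Automaton F ar} {V : Type} {τ : V → A.Q} {s : V → GTm F ar}
    (hs : ∀ v, A.AcceptsG (s v) (τ v)) {p : Tm F ar V} {q : A.Q} (h : Accepts A (p.map τ) q) :
    A.AcceptsG (p.subst s) q := by
  induction p generalizing q with
  | var v =>
    obtain rfl := accepts_var_iff.1 h
    exact hs v
  | node f ts ih =>
    obtain ⟨qs, h1, h2⟩ := accepts_node_iff.1 h
    exact acceptsG_node_iff.2 ⟨qs, fun i => ih i (h1 i), h2⟩

/-- Determinism extends to terms over states, since all states are reachable. -/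
theorem accepts_unique (G : EGraph F ar) {t : Tm F ar G.Q} {q1 q2 : G.Q}
    (h1 : Accepts G.toAutomaton t q1) (h2 : Accepts G.toAutomaton t q2) : q1 = q2 := by
  choose s hs using G.reach
  rw [← map_id t] at h1 h2
  exact G.det _ _ _ (acceptsG_subst (τ := id) hs h1) (acceptsG_subst (τ := id) hs h2)

theorem deterministic_of_functional {A : Automaton F ar}
    (h : ∀ f qs q q', (qs, q) ∈ A.trans f → (qs, q') ∈ A.trans f → q = q') :
    A.Deterministic := by
  intro t
  induction t with
  | var v => exact v.elim
  | node f ts ih =>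
    intro q1 q2 h1 h2
    obtain ⟨qs1, a1, b1⟩ := acceptsG_node_iff.1 h1
    obtain ⟨qs2, a2, b2⟩ := acceptsG_node_iff.1 h2
    obtain rfl : qs1 = qs2 := funext fun i => ih i _ _ (a1 i) (a2 i)
    exact h _ _ _ _ b1 b2

/-- A homomorphism into an E-graph is determined by a choice of representative terms. -/
theorem ale_of_rep {A : Automaton F ar} (H : EGraph F ar) (rep : A.Q → GTm F ar)
    (h1 : ∀ q, ∃ s, H.toAutomaton.AcceptsG (rep q) s)
    (h2 : ∀ f (qs : Fin (ar f) → A.Q) q, (qs, q) ∈ A.trans f →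
      ∃ s, H.toAutomaton.AcceptsG (.node f fun i => rep (qs i)) s ∧
        H.toAutomaton.AcceptsG (rep q) s) :
    ALe A H.toAutomaton := by
  choose g hg using h1
  refine ⟨⟨g, fun f qs q h => ?_⟩⟩
  obtain ⟨s, hs, hq⟩ := h2 f qs q h
  obtain rfl := H.det _ _ _ hq (hg q)
  obtain ⟨rs, hr, ht⟩ := acceptsG_node_iff.1 hs
  obtain rfl : rs = fun i => g (qs i) := funext fun i => H.det _ _ _ (hr i) (hg _)
  exact ht

theorem ale_refl (A : Automaton F ar) : ALe A A := ⟨⟨id, fun _ _ _ h => h⟩⟩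

theorem ale_trans {A B C : Automaton F ar} (h1 : ALe A B) (h2 : ALe B C) : ALe A C := by
  obtain ⟨g⟩ := h1
  obtain ⟨g'⟩ := h2
  exact ⟨⟨g'.toFun ∘ g.toFun, fun f qs q h => g'.map_trans _ _ _ (g.map_trans _ _ _ h)⟩⟩

theorem exists_accepts_subterm {A : Automaton F ar} {u t : Tm F ar A.Q} (h : Subterm u t)
    {q : A.Q} (ht : Accepts A t q) : ∃ q', Accepts A u q' := by
  induction h generalizing q with
  | refl => exact ⟨q, ht⟩
  | node i _ ih =>
    obtain ⟨qs, h1, -⟩ := accepts_node_iff.1 ht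
    exact ih (h1 i)

theorem subterm_map {V W : Type} (g : V → W) {u t : Tm F ar V} (h : Subterm u t) :
    Subterm (u.map g) (t.map g) := by
  induction h with
  | refl => exact .refl _
  | node i _ ih => exact .node i ih

/-- The match/apply operator inserts the instantiated right-hand side of every match. -/
theorem accepts_TRaut (R : TRS F ar) (G : EGraph F ar) (m : EMatch R G)
    {f : F} {ts : Fin (ar f) → Tm F ar ℕ} (hr : m.rhs = .node f ts) :
    Accepts (TRaut R G) (m.rhs.map (Sum.inl ∘ m.sub)) (Sum.inl m.root) := by
  have key : ∀ (u : Tm F ar G.Q) (h : Subterm u (Tm.map m.sub m.rhs)),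
      Accepts (TRaut R G) (u.map Sum.inl) (stateOf R G m u h) := by
    intro u
    induction u with
    | var q => intro h; exact .var _
    | node f ts ih =>
      intro h
      exact .node (fun i => ih i (Subterm.child i h)) (.inr ⟨m, ts, h, rfl⟩)
  have root : ∀ (u : Tm F ar G.Q) (h : Subterm u (Tm.map m.sub m.rhs)) (g : F) (us),
      u = .node g us → u = Tm.map m.sub m.rhs → stateOf R G m u h = Sum.inl m.root := by
    rintro u h g us rfl hu
    simp only [stateOf]
    exact if_pos hu
  have h := key _ (.refl _)
  rw [root _ _ f (fun i => (ts i).map m.sub) (by rw [hr]; rfl) rfl] at h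
  exact (congrArg (fun t => Accepts (TRaut R G) t _) (map_map Sum.inl m.sub m.rhs)).mp h

theorem accepts_rhs_of_match {R : TRS F ar} {G H : EGraph F ar} (k : AHom (TRaut R G) H.toAutomaton)
    {l : Tm F ar ℕ} {f : F} {ts : Fin (ar f) → Tm F ar ℕ} (hm : (l, .node f ts) ∈ R.rules)
    {σ : ℕ → G.Q} {c : G.Q} (h : Accepts G.toAutomaton (l.map σ) c) :
    Accepts H.toAutomaton (Tm.map (fun v => k.toFun (Sum.inl (σ v))) (.node f ts))
      (k.toFun (Sum.inl c)) := by
  have := accepts_map k (accepts_TRaut R G ⟨l, .node f ts, hm, σ, c, h⟩ rfl)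
  rwa [map_map] at this

/-- The embedding of `G` into the result of the match/apply operator. -/
noncomputable def inlHom (R : TRS F ar) (G : EGraph F ar) :
    AHom G.toAutomaton (TRaut R G) where
  toFun := Sum.inl
  map_trans _ qs q h := .inl ⟨qs, q, h, rfl⟩

/-- A homomorphism `G → H` extends to the result of the match/apply operator as soon as `H`
accepts the right-hand side of every match in `G`. -/
theorem TRaut_ale {R : TRS F ar} {G H : EGraph F ar} (g : AHom G.toAutomaton H.toAutomaton)
    (hm : ∀ l r, (l, r) ∈ R.rules → ∀ (σ : ℕ → G.Q) (c : G.Q), Accepts G.toAutomaton (l.map σ) c →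
      Accepts H.toAutomaton (r.map (g.toFun ∘ σ)) (g.toFun c)) :
    ALe (TRaut R G) H.toAutomaton := by
  have hrhs (m : EMatch R G) :
      Accepts H.toAutomaton ((Tm.map m.sub m.rhs).map g.toFun) (g.toFun m.root) := by
    rw [map_map]
    exact hm _ _ m.mem _ _ m.acc
  have hex (x : MExtra R G) : ∃ q, Accepts H.toAutomaton (x.1.2.map g.toFun) q :=
    exists_accepts_subterm (subterm_map _ x.2) (hrhs x.1.1)
  choose k hk using hex
  let φ : G.Q ⊕ MExtra R G → H.Q := Sum.elim g.toFun k
  have key (m : EMatch R G) (u : Tm F ar G.Q) (h : Subterm u (Tm.map m.sub m.rhs)) :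
      Accepts H.toAutomaton (u.map g.toFun) (φ (stateOf R G m u h)) := by
    cases u with
    | var q => exact .var _
    | node f ts =>
      simp only [stateOf]
      split_ifs with he
      · rw [he]
        exact hrhs m
      · exact hk ⟨(m, .node f ts), h⟩
  refine ⟨⟨φ, ?_⟩⟩
  rintro f qs q (⟨ps, p, hp, he⟩ | ⟨m, ts, h, he⟩)
  · obtain ⟨rfl, rfl⟩ := Prod.mk.inj he
    exact g.map_trans _ _ _ hp
  · obtain ⟨rfl, rfl⟩ := Prod.mk.inj he
    obtain ⟨rs, h1, h2⟩ := accepts_node_iff.1 (key m _ h)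
    obtain rfl : rs = fun i => φ (stateOf R G m (ts i) (Subterm.child i h)) :=
      funext fun i => accepts_unique H (h1 i) (key m _ _)
    exact h2

end Generic

/-! ## The encoding of Skolem terms and atoms -/

section Encoding

variable {RS : Type} {rar : RS → ℕ} {C : Type}

/-- The active domain of an instance. -/
def activeDom {D : Type} (J : DBInst RS rar D) : Set D := { x | ∃ a ∈ J, ∃ i, a.2 i = x }

/-- The existential variables of a TGD. -/
def exVars (d : TGDep RS rar) : Set ℕ := { z | ∃ a ∈ d.head, ∃ i, a.2 i = Sum.inr z }

theorem finite_headVars (d : TGDep RS rar) :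
    (⋃ a ∈ { a | a ∈ d.head }, Set.range a.2).Finite :=
  (List.finite_toSet d.head).biUnion fun a _ => Set.finite_range a.2

theorem finite_exVars (d : TGDep RS rar) : (exVars d).Finite := by
  refine ((finite_headVars d).preimage Sum.inr_injective.injOn).subset ?_
  rintro z ⟨a, ha, i, hi⟩
  exact Set.mem_biUnion ha ⟨i, hi⟩

instance finite_frontier (d : TGDep RS rar) : Finite { v : ℕ // d.IsFrontier v } := by
  refine Set.Finite.to_subtype (s := { v | d.IsFrontier v })
    (((finite_headVars d).preimage Sum.inl_injective.injOn).subset ?_)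
  rintro z ⟨a, ha, i, hi⟩
  exact Set.mem_biUnion ha ⟨i, hi⟩

theorem finite_activeDom {D : Type} {J : DBInst RS rar D} (hJ : J.Finite) :
    (activeDom J).Finite := by
  refine (hJ.biUnion fun a _ => Set.finite_range a.2).subset ?_
  rintro x ⟨a, ha, i, hi⟩
  exact Set.mem_biUnion ha ⟨i, hi⟩

/-- An enumeration of the frontier variables of a TGD. -/
noncomputable def frontierEquiv (d : TGDep RS rar) :
    { v : ℕ // d.IsFrontier v } ≃ Fin (Nat.card { v : ℕ // d.IsFrontier v }) :=
  Finite.equivFin _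

/-- Function symbols: the truth constant, binary conjunction, the relation symbols, the
constants of `I` and the Skolem functions of `Γ`. -/
inductive Sym (Γ : Set (TGDep RS rar)) (I : DBInst RS rar C) : Type where
  | tt : Sym Γ I
  | conj : Sym Γ I
  | rel : RS → Sym Γ I
  | cst : activeDom I → Sym Γ I
  | sk : (d : Γ) → exVars d.1 → Sym Γ I

variable {Γ : Set (TGDep RS rar)} {I : DBInst RS rar C}

/-- The arities of the function symbols. -/
noncomputable def arity : Sym Γ I → ℕ
  | .tt => 0
  | .conj => 2
  | .rel r => rar r
  | .cst _ => 0
  | .sk d _ => Nat.card { v : ℕ // d.1.IsFrontier v }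

theorem finite_sym [Finite RS] (hΓ : Γ.Finite) (hI : I.Finite) : Finite (Sym Γ I) := by
  have := hΓ.to_subtype
  have := (finite_activeDom hI).to_subtype
  have (d : Γ) : Finite (exVars d.1) := (finite_exVars d.1).to_subtype
  let g : (Unit ⊕ Unit) ⊕ RS ⊕ activeDom I ⊕ (Σ d : Γ, exVars d.1) → Sym Γ I :=
    Sum.elim (Sum.elim (fun _ => .tt) fun _ => .conj)
      (Sum.elim .rel (Sum.elim .cst fun p => .sk p.1 p.2))
  refine Finite.of_surjective g ?_
  rintro (_ | _ | r | c | ⟨d, z⟩)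
  · exact ⟨.inl (.inl ()), rfl⟩
  · exact ⟨.inl (.inr ()), rfl⟩
  · exact ⟨.inr (.inl r), rfl⟩
  · exact ⟨.inr (.inr (.inl c)), rfl⟩
  · exact ⟨.inr (.inr (.inr ⟨d, z⟩)), rfl⟩

variable (Γ I) in
/-- Ground terms over the signature of the reduction. -/
abbrev Gd : Type := GTm (Sym Γ I) arity

variable (Γ I) in
/-- Patterns over the signature of the reduction. -/
abbrev Pat : Type := Tm (Sym Γ I) arity ℕ

/-- The truth constant as a term. -/
def ttm {V : Type} : Tm (Sym Γ I) arity V := .node .tt fun i => i.elim0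

/-- Conjunction of terms. -/
def conjm {V : Type} (a b : Tm (Sym Γ I) arity V) : Tm (Sym Γ I) arity V :=
  .node .conj (![a, b] : Fin 2 → Tm (Sym Γ I) arity V)

/-- Application of a relation symbol. -/
def relm {V : Type} (r : RS) (ts : Fin (rar r) → Tm (Sym Γ I) arity V) :
    Tm (Sym Γ I) arity V :=
  .node (.rel r) ts

/-- Application of a Skolem function, with arguments indexed by frontier variables. -/
noncomputable def skm {V : Type} (d : Γ) (z : exVars d.1)
    (ts : { v : ℕ // d.1.IsFrontier v } → Tm (Sym Γ I) arity V) : Tm (Sym Γ I) arity V :=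
  .node (.sk d z) fun i => ts ((frontierEquiv d.1).symm i)

open Classical in
variable (Γ I) in
/-- The encoding of Skolem terms. Terms built from symbols outside the signature are sent to
the truth constant. -/
noncomputable def enc : SkT RS rar C → Gd Γ I
  | .const c => if h : c ∈ activeDom I then .node (.cst ⟨c, h⟩) fun i => i.elim0 else ttm
  | .sk d z xs =>
      if h : ∃ _ : d ∈ Γ, z ∈ exVars d then skm ⟨d, h.1⟩ ⟨z, h.2⟩ fun v => enc (xs v) else ttm

theorem enc_const {c : C} (h : c ∈ activeDom I) :
    enc Γ I (.const c) = .node (.cst ⟨c, h⟩) fun i => i.elim0 :=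
  dif_pos h

theorem enc_sk {d : TGDep RS rar} {z : ℕ} (hd : d ∈ Γ) (hz : z ∈ exVars d)
    (xs : { v : ℕ // d.IsFrontier v } → SkT RS rar C) :
    enc Γ I (.sk d z xs) = skm ⟨d, hd⟩ ⟨z, hz⟩ fun v => enc Γ I (xs v) :=
  dif_pos (show ∃ _ : d ∈ Γ, z ∈ exVars d from ⟨hd, hz⟩)

variable (Γ I) in
/-- The encoding of atoms. -/
noncomputable def encA (a : DBAtom RS rar (SkT RS rar C)) : Gd Γ I :=
  relm a.1 fun i => enc Γ I (a.2 i)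

variable (Γ I) in
/-- Instances whose active domain consists of Skolem terms over the signature and is closed
under subterms. -/
def ClosedInst (J : DBInst RS rar (SkT RS rar C)) : Prop :=
  ∀ x ∈ activeDom J, match x with
    | .const c => c ∈ activeDom I
    | .sk d z xs => d ∈ Γ ∧ z ∈ exVars d ∧ ∀ v, xs v ∈ activeDom J

variable {J J' : DBInst RS rar (SkT RS rar C)}

/-- Induction over the active domain of a closed instance. -/
theorem ClosedInst.rec_on {motive : ∀ x, x ∈ activeDom J → Prop} (hJ : ClosedInst Γ I J)
    (const : ∀ c (_ : c ∈ activeDom I) h, motive (.const c) h)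
    (sk : ∀ d z xs (_ : d ∈ Γ) (_ : z ∈ exVars d) (hv : ∀ v, xs v ∈ activeDom J)
      (_ : ∀ v, motive (xs v) (hv v)) h, motive (.sk d z xs) h)
    (x : SkT RS rar C) (hx : x ∈ activeDom J) : motive x hx := by
  induction x with
  | const c => exact const c (hJ _ hx) hx
  | sk d z xs ih =>
    obtain ⟨hd, hz, hv⟩ := hJ _ hx
    exact sk d z xs hd hz hv (fun v => ih v (hv v)) hx

theorem skm_inj {V : Type} {d : Γ} {z : exVars d.1}
    {ts ts' : { v : ℕ // d.1.IsFrontier v } → Tm (Sym Γ I) arity V}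
    (h : skm d z ts = skm d z ts') : ts = ts' := by
  funext v
  have := congrFun (Tm.node.inj h |>.2 |> eq_of_heq) (frontierEquiv d.1 v)
  simpa using this

theorem enc_injective_of_closed (hJ : ClosedInst Γ I J) {x y : SkT RS rar C}
    (hx : x ∈ activeDom J) (h : enc Γ I x = enc Γ I y) : x = y := by
  induction x, hx using hJ.rec_on generalizing y with
  | const c hc =>
    rw [enc_const hc] at h
    cases y with
    | const c' =>
      by_cases hc' : c' ∈ activeDom I
      · rw [enc_const hc'] at h
        injection h with h1
        injection h1 with h1
        injection h1 with h1
        rw [h1]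
      · rw [enc, dif_neg hc'] at h
        injection h with h1
        cases h1
    | sk d z xs =>
      unfold enc at h
      split_ifs at h <;> · injection h with h1; cases h1
  | sk d z xs hd hz _ ih =>
    rw [enc_sk hd hz] at h
    cases y with
    | const c =>
      unfold enc at h
      split_ifs at h <;> · injection h with h1; cases h1
    | sk d' z' xs' =>
      by_cases h' : ∃ _ : d' ∈ Γ, z' ∈ exVars d'
      · rw [enc_sk h'.1 h'.2] at h
        have h1 := (Tm.node.inj h).1
        injection h1 with h2 h3
        injection h2 with h2
        subst h2
        injection eq_of_heq h3 with h3
        subst h3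
        congr 1
        funext v
        exact ih v (congrFun (skm_inj h) v)
      · rw [enc.eq_2 Γ I d', dif_neg h'] at h
        injection h with h1
        cases h1

theorem enc_eq_node_of_closed (hJ : ClosedInst Γ I J) {x : SkT RS rar C}
    (hx : x ∈ activeDom J) {f : Sym Γ I} {ts : Fin (arity f) → Gd Γ I}
    (h : enc Γ I x = .node f ts) :
    f ≠ .tt ∧ f ≠ .conj ∧ (∀ r, f ≠ .rel r) ∧ ∀ i, ∃ y ∈ activeDom J, enc Γ I y = ts i := by
  cases x with
  | const c =>
    have hc : c ∈ activeDom I := hJ _ hx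
    rw [enc_const hc] at h
    cases h
    exact ⟨nofun, nofun, nofun, fun i => i.elim0⟩
  | sk d z xs =>
    obtain ⟨hd, hz, hv⟩ := hJ _ hx
    rw [enc_sk hd hz] at h
    cases h
    exact ⟨nofun, nofun, nofun, fun i => ⟨_, hv _, rfl⟩⟩

theorem enc_ne_ttm (hJ : ClosedInst Γ I J) {x : SkT RS rar C} (hx : x ∈ activeDom J) :
    enc Γ I x ≠ ttm :=
  fun h => (enc_eq_node_of_closed hJ hx h).1 rfl

/-! ## The E-graph of an instance -/

variable (Γ I) in
/-- The terms in the class of the truth constant. The proposition `b` says whether the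
conjunction of the truth constant with itself is present. -/
inductive IsTrue (J : DBInst RS rar (SkT RS rar C)) (b : Prop) : Gd Γ I → Prop where
  | tt : IsTrue J b ttm
  | conj : b → IsTrue J b (conjm ttm ttm)
  | atom (a) : a ∈ J → IsTrue J b (encA Γ I a)

variable (Γ I) in
/-- The automaton of an instance: one state for the truth constant, which accepts the atoms
of the instance, and one state for every element of the active domain. -/
def instAut (J : DBInst RS rar (SkT RS rar C)) (b : Prop) : Automaton (Sym Γ I) arity where
  Q := { t : Gd Γ I // t = ttm ∨ ∃ x ∈ activeDom J, enc Γ I x = t }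
  trans f := { p | (IsTrue Γ I J b (.node f fun i => (p.1 i).1) ∧ p.2.1 = ttm) ∨
    .node f (fun i => (p.1 i).1) = p.2.1 }

variable {b b' : Prop}

theorem isTrue_enc (hJ : ClosedInst Γ I J) {x : SkT RS rar C} (hx : x ∈ activeDom J)
    (h : IsTrue Γ I J b (enc Γ I x)) : False := by
  generalize ht : enc Γ I x = t at h
  cases h with
  | tt => exact (enc_eq_node_of_closed hJ hx ht).1 rfl
  | conj _ => exact (enc_eq_node_of_closed hJ hx ht).2.1 rfl
  | atom a _ => exact (enc_eq_node_of_closed hJ hx ht).2.2.1 _ rfl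

theorem isTrue_conj {ts : Fin 2 → Gd Γ I} (h : IsTrue Γ I J b (.node .conj ts)) :
    b ∧ ∀ i, ts i = ttm := by
  generalize ht : (Tm.node .conj ts : Gd Γ I) = t at h
  cases h with
  | tt => cases ht
  | conj hb =>
    cases ht
    refine ⟨hb, fun i => ?_⟩
    fin_cases i <;> rfl
  | atom a _ => cases ht

theorem isTrue_rel {r : RS} {ts : Fin (rar r) → Gd Γ I} (h : IsTrue Γ I J b (.node (.rel r) ts)) :
    ∃ xs, (⟨r, xs⟩ : DBAtom RS rar (SkT RS rar C)) ∈ J ∧ ∀ i, enc Γ I (xs i) = ts i := by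
  generalize ht : (Tm.node (.rel r) ts : Gd Γ I) = t at h
  cases h with
  | tt => cases ht
  | conj hb => cases ht
  | atom a ha =>
    obtain ⟨s, xs⟩ := a
    cases ht
    exact ⟨xs, ha, fun _ => rfl⟩

/-- The state of the truth constant. -/
def ttState (J : DBInst RS rar (SkT RS rar C)) (b : Prop) : (instAut Γ I J b).Q :=
  ⟨ttm, .inl rfl⟩

theorem acceptsG_ttState : (instAut Γ I J b).AcceptsG ttm (ttState J b) :=
  acceptsG_node_iff.2 ⟨fun i => i.elim0, fun i => i.elim0, .inr (by
    unfold ttState ttm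
    congr 1
    funext i
    exact i.elim0)⟩

theorem acceptsG_self (hJ : ClosedInst Γ I J) (q : (instAut Γ I J b).Q) :
    (instAut Γ I J b).AcceptsG q.1 q := by
  obtain ⟨t, rfl | ⟨x, hx, rfl⟩⟩ := q
  · exact acceptsG_ttState
  have key : ∀ q : (instAut Γ I J b).Q, q.1 = enc Γ I x → (instAut Γ I J b).AcceptsG q.1 q := by
    induction x, hx using hJ.rec_on with
    | const c hc =>
      intro q hq
      rw [enc_const hc] at hq
      rw [hq]
      refine acceptsG_node_iff.2 ⟨fun i => i.elim0, fun i => i.elim0, .inr ?_⟩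
      rw [hq]
      congr 1
      funext i
      exact i.elim0
    | sk d z xs hd hz hv ih =>
      intro q hq
      rw [enc_sk hd hz] at hq
      rw [hq]
      refine acceptsG_node_iff.2 ⟨fun i => ⟨_, .inr ⟨_, hv ((frontierEquiv d).symm i), rfl⟩⟩,
        fun i => ih _ ⟨_, .inr ⟨_, hv _, rfl⟩⟩ rfl, .inr ?_⟩
      rw [hq]
      rfl
  exact key _ rfl

theorem instAut_deterministic (hJ : ClosedInst Γ I J) : (instAut Γ I J b).Deterministic := by
  apply deterministic_of_functional
  have key : ∀ t (q : (instAut Γ I J b).Q), IsTrue Γ I J b t → t = q.1 → q.1 = ttm := by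
    rintro t ⟨_, rfl | ⟨x, hx, rfl⟩⟩ ht rfl
    · rfl
    · exact (isTrue_enc hJ hx ht).elim
  rintro f qs q q' (⟨h1, h2⟩ | h) (⟨h1', h2'⟩ | h')
  · exact Subtype.ext (h2.trans h2'.symm)
  · exact Subtype.ext (h2.trans (key _ q' h1 h').symm)
  · exact Subtype.ext ((key _ q h1' h).trans h2'.symm)
  · exact Subtype.ext (h.symm.trans h')

/-- The E-graph of a closed instance. -/
def instEG (J : DBInst RS rar (SkT RS rar C)) (b : Prop) (hJ : ClosedInst Γ I J) :
    EGraph (Sym Γ I) arity where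
  toAutomaton := instAut Γ I J b
  det := instAut_deterministic hJ
  reach q := ⟨q.1, acceptsG_self hJ q⟩

theorem eq_enc_of_acceptsG (hJ : ClosedInst Γ I J) {x : SkT RS rar C} (hx : x ∈ activeDom J)
    {t : Gd Γ I} {q : (instAut Γ I J b).Q} (h : (instAut Γ I J b).AcceptsG t q)
    (hq : q.1 = enc Γ I x) : t = enc Γ I x := by
  induction t generalizing x q with
  | var e => exact e.elim
  | node f ts ih =>
    obtain ⟨qs, h1, ⟨-, h2⟩ | h2⟩ := acceptsG_node_iff.1 h
    · exact (enc_ne_ttm hJ hx (hq.symm.trans h2)).elim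
    · rw [hq] at h2
      rw [← h2]
      congr 1
      funext i
      obtain ⟨y, hy, he⟩ := (enc_eq_node_of_closed hJ hx h2.symm).2.2.2 i
      exact (ih i hy (h1 i) he.symm).trans he

theorem trans_rel (hJ : ClosedInst Γ I J) {r : RS} {qs : Fin (rar r) → (instAut Γ I J b).Q}
    {q : (instAut Γ I J b).Q} (h : (qs, q) ∈ (instAut Γ I J b).trans (.rel r)) :
    ∃ xs, (⟨r, xs⟩ : DBAtom RS rar (SkT RS rar C)) ∈ J ∧ ∀ i, enc Γ I (xs i) = (qs i).1 := by
  obtain ⟨h, -⟩ | h := h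
  · exact isTrue_rel h
  · obtain ⟨t, rfl | ⟨x, hx, rfl⟩⟩ := q
    · cases h
    · exact ((enc_eq_node_of_closed hJ hx h.symm).2.2.1 _ rfl).elim

theorem acceptsG_encA (hJ : ClosedInst Γ I J) {a : DBAtom RS rar (SkT RS rar C)} (ha : a ∈ J) :
    (instAut Γ I J b).AcceptsG (encA Γ I a) (ttState J b) :=
  acceptsG_node_iff.2 ⟨fun i => ⟨enc Γ I (a.2 i), .inr ⟨_, ⟨a, ha, i, rfl⟩, rfl⟩⟩,
    fun i => acceptsG_self hJ ⟨enc Γ I (a.2 i), _⟩, .inl ⟨.atom a ha, rfl⟩⟩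

theorem acceptsG_encA_iff (hJ : ClosedInst Γ I J) {a : DBAtom RS rar (SkT RS rar C)} :
    (∃ q, (instAut Γ I J b).AcceptsG (encA Γ I a) q) ↔ a ∈ J := by
  constructor
  · rintro ⟨q, h⟩
    obtain ⟨qs, h1, h2⟩ := acceptsG_node_iff.1 h
    obtain ⟨xs, ha, hx⟩ := trans_rel hJ h2
    convert ha
    funext i
    have hd : xs i ∈ activeDom J := ⟨_, ha, i, rfl⟩
    exact (enc_injective_of_closed hJ hd
      (eq_enc_of_acceptsG hJ hd (h1 i) (hx i).symm).symm).symm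
  · intro ha
    exact ⟨ttState J b, acceptsG_encA hJ ha⟩

/-- An E-graph with a state accepting the truth constant, the atoms of `J` and possibly a
conjunction lies above the E-graph of `J`. -/
theorem instAut_ale (H : EGraph (Sym Γ I) arity) (s : H.Q)
    (hs : ∀ t, IsTrue Γ I J b t → H.toAutomaton.AcceptsG t s) :
    ALe (instAut Γ I J b) H.toAutomaton := by
  have hrep (q : (instAut Γ I J b).Q) : ∃ s, H.toAutomaton.AcceptsG q.1 s := by
    obtain ⟨t, rfl | ⟨x, ⟨a, ha, i, rfl⟩, rfl⟩⟩ := q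
    · exact ⟨s, hs _ .tt⟩
    · obtain ⟨qs, h1, -⟩ := acceptsG_node_iff.1 (hs _ (.atom a ha))
      exact ⟨_, h1 i⟩
  refine ale_of_rep H Subtype.val hrep ?_
  rintro f qs q (⟨h1, h2⟩ | h)
  · exact ⟨s, hs _ h1, by rw [h2]; exact hs _ .tt⟩
  · obtain ⟨s', h'⟩ := hrep q
    exact ⟨s', by rwa [show Tm.node f (fun i => (qs i).1) = q.1 from h], h'⟩

/-- The homomorphism induced by an inclusion of instances. -/
def instHom (h : J ⊆ J') (hb : b → b') : AHom (instAut Γ I J b) (instAut Γ I J' b') where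
  toFun q := ⟨q.1, q.2.imp_right fun ⟨x, ⟨a, ha, hx⟩, hq⟩ => ⟨x, ⟨a, h ha, hx⟩, hq⟩⟩
  map_trans f qs q := by
    rintro (⟨h1, h2⟩ | h1)
    · refine .inl ⟨?_, h2⟩
      change IsTrue Γ I J' b' (.node f fun i => (qs i).1)
      generalize (Tm.node f fun i => (qs i).1 : Gd Γ I) = t at h1
      cases h1 with
      | tt => exact .tt
      | conj h => exact .conj (hb h)
      | atom a ha => exact .atom a (h ha)
    · exact .inr h1

/-! ## The rewrite system -/

/-- The pattern of a body atom. -/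
def atomPat (a : DBAtom RS rar ℕ) : Pat Γ I := relm a.1 fun i => .var (a.2 i)

/-- The pattern of the body of a TGD, a nested conjunction. -/
def bodyPat : List (DBAtom RS rar ℕ) → Pat Γ I
  | [] => conjm ttm ttm
  | a :: l => conjm (atomPat a) (bodyPat l)

open Classical in
/-- The pattern of a variable in the head of a Skolemized TGD. -/
noncomputable def headVarPat (d : Γ) : ℕ ⊕ ℕ → Pat Γ I
  | .inl v => .var v
  | .inr z => if h : z ∈ exVars d.1 then skm d ⟨z, h⟩ fun v => .var v.1 else ttm

/-- The pattern of a head atom of a Skolemized TGD. -/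
noncomputable def headPat (d : Γ) (a : DBAtom RS rar (ℕ ⊕ ℕ)) : Pat Γ I :=
  relm a.1 fun i => headVarPat d (a.2 i)

theorem mem_vars_bodyPat {l : List (DBAtom RS rar ℕ)} {a : DBAtom RS rar ℕ} (ha : a ∈ l)
    (i : Fin (rar a.1)) : a.2 i ∈ Tm.vars (bodyPat l : Pat Γ I) := by
  induction l with
  | nil => cases ha
  | cons c l ih =>
    have hv : Tm.vars (bodyPat (c :: l) : Pat Γ I) =
        ⋃ j : Fin 2, Tm.vars ((![atomPat c, bodyPat l] : Fin 2 → Pat Γ I) j) := rfl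
    rw [hv]
    rcases List.mem_cons.1 ha with rfl | ha
    · exact Set.mem_iUnion.2 ⟨0, Set.mem_iUnion.2 ⟨i, rfl⟩⟩
    · exact Set.mem_iUnion.2 ⟨1, ih ha⟩

theorem vars_headPat {d : Γ} {a : DBAtom RS rar (ℕ ⊕ ℕ)} (ha : a ∈ d.1.head) :
    Tm.vars (headPat d a : Pat Γ I) ⊆ { v | d.1.IsFrontier v } := by
  intro v hv
  obtain ⟨i, hi⟩ := Set.mem_iUnion.1 hv
  change Fin (rar a.1) at i
  change v ∈ Tm.vars (headVarPat d (a.2 i)) at hi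
  cases hai : a.2 i with
  | inl w =>
    rw [hai] at hi
    obtain rfl : v = w := hi
    exact ⟨a, ha, i, hai⟩
  | inr z =>
    have hz : z ∈ exVars d.1 := ⟨a, ha, i, hai⟩
    rw [hai, headVarPat, dif_pos hz] at hi
    obtain ⟨j, hj⟩ := Set.mem_iUnion.1 hi
    obtain rfl := Set.mem_singleton_iff.1 hj
    exact ((frontierEquiv d.1).symm j).2

variable (Γ I) in
/-- The rules of the reduction: introduction of a conjunction, of the initial atoms, and of
the head atoms of the TGDs. -/
def ruleSet : Set (Pat Γ I × Pat Γ I) :=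
  {(ttm, GTm.embed (conjm ttm ttm))} ∪ (fun a => (ttm, GTm.embed (encA Γ I a))) '' skBase I ∪
    { p | ∃ d : Γ, ∃ a ∈ d.1.head, (bodyPat d.1.body, headPat d a) = p }

/-- The rewrite system of the reduction. -/
def chaseTRS (hΓ : Γ.Finite) (hI : I.Finite) : TRS (Sym Γ I) arity where
  rules := ruleSet Γ I
  finite := by
    have := hΓ.to_subtype
    refine ((Set.finite_singleton _).union ((hI.image _).image _)).union ?_
    refine (Set.finite_iUnion fun d : Γ => (List.finite_toSet d.1.head).image
      fun a => ((bodyPat d.1.body, headPat d a) : Pat Γ I × Pat Γ I)).subset ?_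
    rintro p ⟨d, a, ha, rfl⟩
    exact Set.mem_iUnion.2 ⟨d, a, ha, rfl⟩
  var_cond := by
    rintro r ((rfl | ⟨a, -, rfl⟩) | ⟨d, a, ha, rfl⟩)
    · simp only [vars_embed, Set.empty_subset]
    · simp only [vars_embed, Set.empty_subset]
    · intro v hv
      obtain ⟨c, hc, j, rfl⟩ := d.1.safe v (vars_headPat ha hv)
      exact mem_vars_bodyPat hc j

theorem accepts_conjm {V : Type} {A : Automaton (Sym Γ I) arity} {s t : Tm (Sym Γ I) arity V}
    {τ : V → A.Q} {q : A.Q} :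
    Accepts A ((conjm s t).map τ) q ↔ ∃ qs : Fin 2 → A.Q, Accepts A (s.map τ) (qs 0) ∧
      Accepts A (t.map τ) (qs 1) ∧ (qs, q) ∈ A.trans .conj := by
  refine accepts_node_iff.trans ⟨?_, ?_⟩
  · rintro ⟨qs, h1, h2⟩
    exact ⟨qs, h1 (0 : Fin 2), h1 (1 : Fin 2), h2⟩
  · rintro ⟨qs, h1, h2, h3⟩
    refine ⟨qs, fun i => ?_, h3⟩
    change Fin 2 at i
    fin_cases i
    · exact h1
    · exact h2

theorem trans_conj (hJ : ClosedInst Γ I J) {qs : Fin 2 → (instAut Γ I J b).Q}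
    {q : (instAut Γ I J b).Q} :
    (qs, q) ∈ (instAut Γ I J b).trans .conj ↔
      b ∧ (∀ i, qs i = ttState J b) ∧ q = ttState J b := by
  constructor
  · rintro (⟨h1, h2⟩ | h)
    · obtain ⟨hb, h⟩ := isTrue_conj h1
      exact ⟨hb, fun i => Subtype.ext (h i), Subtype.ext h2⟩
    · obtain ⟨t, rfl | ⟨x, hx, rfl⟩⟩ := q
      · cases h
      · exact ((enc_eq_node_of_closed hJ hx h.symm).2.1 rfl).elim
  · rintro ⟨hb, h, rfl⟩
    obtain rfl : qs = fun _ => ttState J b := funext h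
    refine .inl ⟨?_, rfl⟩
    convert IsTrue.conj hb using 1
    refine congrArg (Tm.node Sym.conj) (funext fun i => ?_)
    change Fin 2 at i
    fin_cases i <;> rfl

theorem accepts_ttm (hJ : ClosedInst Γ I J) {V : Type} {τ : V → (instAut Γ I J b).Q}
    {q : (instAut Γ I J b).Q} :
    Accepts (instAut Γ I J b) ((ttm : Tm (Sym Γ I) arity V).map τ) q ↔ q = ttState J b := by
  have h : (ttm : Tm (Sym Γ I) arity V).map τ = GTm.embed ttm :=
    congrArg (Tm.node Sym.tt) (funext fun i => i.elim0)
  rw [h]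
  constructor
  · exact fun h => instAut_deterministic hJ _ _ _ h acceptsG_ttState
  · rintro rfl
    exact acceptsG_ttState

theorem accepts_atomPat (hJ : ClosedInst Γ I J) {a : DBAtom RS rar ℕ}
    {τ : ℕ → (instAut Γ I J b).Q} {q : (instAut Γ I J b).Q} :
    Accepts (instAut Γ I J b) ((atomPat a).map τ) q ↔ q = ttState J b ∧
      ∃ xs, (⟨a.1, xs⟩ : DBAtom RS rar (SkT RS rar C)) ∈ J ∧
        ∀ i, enc Γ I (xs i) = (τ (a.2 i)).1 := by
  refine accepts_node_iff.trans ⟨?_, ?_⟩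
  · rintro ⟨qs, h1, h2⟩
    obtain rfl : qs = fun i => τ (a.2 i) := funext fun i => (accepts_var_iff.1 (h1 i)).symm
    refine ⟨?_, trans_rel hJ h2⟩
    obtain ⟨-, h⟩ | h := h2
    · exact Subtype.ext h
    · obtain ⟨t, rfl | ⟨x, hx, rfl⟩⟩ := q
      · rfl
      · exact ((enc_eq_node_of_closed hJ hx h.symm).2.2.1 _ rfl).elim
  · rintro ⟨rfl, xs, ha, hx⟩
    refine ⟨_, fun i => .var _, .inl ⟨?_, rfl⟩⟩
    convert IsTrue.atom (b := b) _ ha using 1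
    exact congrArg (Tm.node (Sym.rel a.1)) (funext fun i => (hx i).symm)

/-- A body pattern matches exactly when all its atoms belong to the instance. -/
theorem accepts_bodyPat (hJ : ClosedInst Γ I J) {l : List (DBAtom RS rar ℕ)}
    {τ : ℕ → (instAut Γ I J b).Q} {q : (instAut Γ I J b).Q} :
    Accepts (instAut Γ I J b) ((bodyPat l).map τ) q ↔ b ∧ q = ttState J b ∧
      ∀ a ∈ l, ∃ xs, (⟨a.1, xs⟩ : DBAtom RS rar (SkT RS rar C)) ∈ J ∧
        ∀ i, enc Γ I (xs i) = (τ (a.2 i)).1 := by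
  induction l generalizing q with
  | nil =>
    rw [bodyPat, accepts_conjm]
    constructor
    · rintro ⟨qs, -, -, h⟩
      obtain ⟨hb, -, rfl⟩ := (trans_conj hJ).1 h
      exact ⟨hb, rfl, nofun⟩
    · rintro ⟨hb, rfl, -⟩
      exact ⟨fun _ => ttState J b, (accepts_ttm hJ).2 rfl, (accepts_ttm hJ).2 rfl,
        (trans_conj hJ).2 ⟨hb, fun _ => rfl, rfl⟩⟩
  | cons a l ih =>
    rw [bodyPat, accepts_conjm]
    constructor
    · rintro ⟨qs, h1, h2, h⟩
      obtain ⟨hb, -, rfl⟩ := (trans_conj hJ).1 h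
      exact ⟨hb, rfl, List.forall_mem_cons.2 ⟨((accepts_atomPat hJ).1 h1).2, (ih.1 h2).2.2⟩⟩
    · rintro ⟨hb, rfl, h⟩
      obtain ⟨h1, h2⟩ := List.forall_mem_cons.1 h
      exact ⟨fun _ => ttState J b, (accepts_atomPat hJ).2 ⟨rfl, h1⟩, ih.2 ⟨hb, rfl, h2⟩,
        (trans_conj hJ).2 ⟨hb, fun _ => rfl, rfl⟩⟩

/-- Instantiating a head pattern yields the encoding of the instantiated head atom. -/
theorem headPat_subst {d : Γ} {a : DBAtom RS rar (ℕ ⊕ ℕ)} (ha : a ∈ d.1.head)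
    {h : ℕ → SkT RS rar C} {s : ℕ → Gd Γ I} (hs : ∀ v, d.1.IsFrontier v → s v = enc Γ I (h v)) :
    (headPat d a : Pat Γ I).subst s = encA Γ I ⟨a.1, fun i => skSub d.1 h (a.2 i)⟩ := by
  refine congrArg (Tm.node (Sym.rel a.1)) (funext fun i => ?_)
  change Fin (rar a.1) at i
  change (headVarPat d (a.2 i)).subst s = enc Γ I (skSub d.1 h (a.2 i))
  cases hai : a.2 i with
  | inl v => exact hs v ⟨a, ha, i, hai⟩
  | inr z =>
    have hz : z ∈ exVars d.1 := ⟨a, ha, i, hai⟩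
    rw [headVarPat, dif_pos hz, skSub, enc_sk d.2 hz]
    exact congrArg (Tm.node (Sym.sk d ⟨z, hz⟩))
      (funext fun j => hs _ ((frontierEquiv d.1).symm j).2)

theorem accepts_headPat {d : Γ} {a : DBAtom RS rar (ℕ ⊕ ℕ)}
    (ha : a ∈ d.1.head) {h : ℕ → SkT RS rar C} {τ : ℕ → (instAut Γ I J b).Q}
    (hs : ∀ v, d.1.IsFrontier v → (τ v).1 = enc Γ I (h v))
    (hJa : (⟨a.1, fun i => skSub d.1 h (a.2 i)⟩ : DBAtom RS rar (SkT RS rar C)) ∈ J) :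
    Accepts (instAut Γ I J b) ((headPat d a).map τ) (ttState J b) := by
  refine accepts_node_iff.2
    ⟨fun i => ⟨enc Γ I (skSub d.1 h (a.2 i)), .inr ⟨_, ⟨_, hJa, i, rfl⟩, rfl⟩⟩, fun i => ?_,
      .inl ⟨.atom _ hJa, rfl⟩⟩
  change Fin (rar a.1) at i
  have key : ∀ q : (instAut Γ I J b).Q, enc Γ I (skSub d.1 h (a.2 i)) = q.1 →
      Accepts (instAut Γ I J b) ((headVarPat d (a.2 i)).map τ) q := ?_
  · exact key _ rfl
  intro q hq
  cases hai : a.2 i with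
  | inl v =>
    rw [hai] at hq
    exact accepts_var_iff.2 (Subtype.ext ((hs v ⟨a, ha, i, hai⟩).trans hq))
  | inr z =>
    have hz : z ∈ exVars d.1 := ⟨a, ha, i, hai⟩
    rw [hai] at hq
    rw [skSub, enc_sk d.2 hz] at hq
    rw [headVarPat, dif_pos hz]
    refine accepts_node_iff.2 ⟨_, fun i => .var _, .inr (Eq.trans ?_ hq)⟩
    exact congrArg (Tm.node (Sym.sk d ⟨z, hz⟩))
      (funext fun j => hs _ ((frontierEquiv d.1).symm j).2)

variable {hΓ : Γ.Finite} {hI : I.Finite} {G H : EGraph (Sym Γ I) arity}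

/-- One round of equality saturation derives at most one round of the chase. -/
theorem TRaut_ale_instAut (hJ : ClosedInst Γ I J) (hJ' : ClosedInst Γ I J') (hsub : J ⊆ J')
    (hbase : skBase I ⊆ J') (hstep : b → skStep Γ J ⊆ J') (hb : b')
    (hG : ALe G.toAutomaton (instAut Γ I J b)) :
    ALe (TRaut (chaseTRS hΓ hI) G) (instAut Γ I J' b') := by
  obtain ⟨g⟩ := hG
  let k : AHom (instAut Γ I J b) (instAut Γ I J' b') := instHom hsub fun _ => hb
  have hk : k.toFun (ttState J b) = ttState J' b' := rfl
  refine TRaut_ale (H := instEG J' b' hJ')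
    ⟨k.toFun ∘ g.toFun, fun f qs q h => k.map_trans _ _ _ (g.map_trans _ _ _ h)⟩ ?_
  intro l r hr σ c hc
  have hc := accepts_map g hc
  rw [map_map] at hc
  change Accepts (instAut Γ I J' b') (r.map fun v => k.toFun (g.toFun (σ v))) (k.toFun (g.toFun c))
  obtain (he | ⟨a, ha, he⟩) | ⟨d, a, ha, he⟩ := hr
  · obtain ⟨rfl, rfl⟩ := Prod.mk.inj he
    rw [(accepts_ttm hJ).1 hc, hk, map_embed]
    exact accepts_conjm.2 ⟨fun _ => ttState J' b', (accepts_ttm hJ').2 rfl,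
      (accepts_ttm hJ').2 rfl, (trans_conj hJ').2 ⟨hb, fun _ => rfl, rfl⟩⟩
  · obtain ⟨rfl, rfl⟩ := Prod.mk.inj he
    rw [(accepts_ttm hJ).1 hc, hk, map_embed]
    exact acceptsG_encA hJ' (hbase ha)
  · obtain ⟨rfl, rfl⟩ := Prod.mk.inj he
    obtain ⟨hb', hc, hbody⟩ := (accepts_bodyPat hJ).1 hc
    rw [hc, hk]
    have hval (v : ℕ) : ∃ x, (∃ y ∈ activeDom J, enc Γ I y = (g.toFun (σ v)).1) →
        x ∈ activeDom J ∧ enc Γ I x = (g.toFun (σ v)).1 := by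
      by_cases h : ∃ y ∈ activeDom J, enc Γ I y = (g.toFun (σ v)).1
      · obtain ⟨y, hy⟩ := h
        exact ⟨y, fun _ => hy⟩
      · exact ⟨.sk ⟨[], [], by simp⟩ 0 fun v => (by simpa [TGDep.IsFrontier] using v.2 : False).elim,
          fun h' => (h h').elim⟩
    choose h hh using hval
    have hbody' : ∀ c ∈ d.1.body, (⟨c.1, fun i => h (c.2 i)⟩ : DBAtom RS rar _) ∈ J ∧
        ∀ i, enc Γ I (h (c.2 i)) = (g.toFun (σ (c.2 i))).1 := by
      intro c hc
      obtain ⟨xs, hxs, he⟩ := hbody c hc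
      have key (i) := hh (c.2 i) ⟨xs i, ⟨_, hxs, i, rfl⟩, he i⟩
      refine ⟨?_, fun i => (key i).2⟩
      obtain rfl : xs = fun i => h (c.2 i) := funext fun i =>
        enc_injective_of_closed hJ ⟨_, hxs, i, rfl⟩ ((he i).trans (key i).2.symm)
      exact hxs
    refine accepts_headPat ha (h := h) ?_
      (hstep hb' (.inr ⟨d.1, d.2, h, fun c hc => (hbody' c hc).1, a, ha, rfl⟩))
    intro v hv
    obtain ⟨c, hc, j, rfl⟩ := d.1.safe v hv
    exact ((hbody' c hc).2 j).symm

/-- One round of equality saturation derives at least one round of the chase. -/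
theorem instAut_ale_of_TRaut (hJ : ClosedInst Γ I J)
    (hJ' : J' ⊆ skBase I ∪ { a | b ∧ a ∈ skStep Γ J }) (hG : ALe (instAut Γ I J b) G.toAutomaton)
    (hH : ALe (TRaut (chaseTRS hΓ hI) G) H.toAutomaton) :
    ALe (instAut Γ I J' b') H.toAutomaton := by
  obtain ⟨g⟩ := hG
  obtain ⟨k⟩ := hH
  let u : G.Q := g.toFun (ttState J b)
  have hself (q : (instAut Γ I J b).Q) :
      H.toAutomaton.AcceptsG q.1 (k.toFun (Sum.inl (g.toFun q))) :=
    acceptsG_map k (acceptsG_map (inlHom _ G) (acceptsG_map g (acceptsG_self hJ q)))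
  have htt : Accepts G.toAutomaton ((ttm : Pat Γ I).map fun _ => u) u := by
    have h : (ttm : Pat Γ I).map (fun _ => u) = GTm.embed ttm :=
      congrArg (Tm.node Sym.tt) (funext fun i => i.elim0)
    rw [h]
    exact acceptsG_map g acceptsG_ttState
  have hground (f) (ts) (hr : (ttm, GTm.embed (.node f ts)) ∈ ruleSet Γ I) :
      H.toAutomaton.AcceptsG (.node f ts) (k.toFun (Sum.inl u)) := by
    have h := accepts_rhs_of_match (R := chaseTRS hΓ hI) (G := G) k hr htt
    have e := map_embed (fun _ : ℕ => k.toFun (Sum.inl u)) (.node f ts : Gd Γ I)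
    exact (congrArg (fun t => Accepts H.toAutomaton t (k.toFun (Sum.inl u))) e).mp h
  refine instAut_ale H (k.toFun (Sum.inl u)) ?_
  rintro t (_ | _ | ⟨a, ha⟩)
  · exact hself (ttState J b)
  · exact hground _ _ (.inl (.inl rfl))
  · obtain ha | ⟨hb, ha | ⟨d, hd, h, hbody, c, hc, rfl⟩⟩ := hJ' ha
    · exact hground _ _ (.inl (.inr ⟨a, ha, rfl⟩))
    · exact acceptsG_map k (acceptsG_map (inlHom _ G) (acceptsG_map g (acceptsG_encA hJ ha)))
    · have hσ (v : ℕ) : ∃ q : (instAut Γ I J b).Q,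
          h v ∈ activeDom J → q.1 = enc Γ I (h v) := by
        by_cases hv : h v ∈ activeDom J
        · exact ⟨⟨_, .inr ⟨_, hv, rfl⟩⟩, fun _ => rfl⟩
        · exact ⟨ttState J b, fun h' => (hv h').elim⟩
      choose σ hσ using hσ
      have hdom : ∀ e ∈ d.body, ∀ i, h (e.2 i) ∈ activeDom J :=
        fun e he i => ⟨_, hbody e he, i, rfl⟩
      have hm := accepts_map g ((accepts_bodyPat hJ (τ := σ)).2 ⟨hb, rfl, fun e he =>
        ⟨_, hbody e he, fun i => (hσ _ (hdom e he i)).symm⟩⟩)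
      rw [map_map] at hm
      have hr := accepts_rhs_of_match (R := chaseTRS hΓ hI) k (.inr ⟨⟨d, hd⟩, c, hc, rfl⟩) hm
      rw [← headPat_subst (d := ⟨d, hd⟩) hc (s := fun v => (σ v).1)]
      · exact acceptsG_subst (fun v => hself (σ v)) hr
      · intro v hv
        obtain ⟨e, he, j, rfl⟩ := d.safe v hv
        exact hσ _ (hdom e he j)

/-! ## The stages of the chase -/

theorem activeDom_mono (h : J ⊆ J') : activeDom J ⊆ activeDom J' :=
  fun _ ⟨a, ha, hx⟩ => ⟨a, h ha, hx⟩

theorem closedInst_skBase : ClosedInst Γ I (skBase I) := by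
  rintro x ⟨_, ⟨a, ha, rfl⟩, i, rfl⟩
  exact ⟨a, ha, i, rfl⟩

theorem ClosedInst.skStep (hJ : ClosedInst Γ I J) : ClosedInst Γ I (skStep Γ J) := by
  have hmono : activeDom J ⊆ activeDom (_root_.skStep Γ J) := activeDom_mono Set.subset_union_left
  have hold : ∀ x ∈ activeDom J, match x with
      | .const c => c ∈ activeDom I
      | .sk d z xs => d ∈ Γ ∧ z ∈ exVars d ∧ ∀ v, xs v ∈ activeDom (_root_.skStep Γ J) := by
    rintro (c | ⟨d, z, xs⟩) hx
    · exact hJ _ hx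
    · obtain ⟨hd, hz, hv⟩ := hJ _ hx
      exact ⟨hd, hz, fun v => hmono (hv v)⟩
  rintro x ⟨a, ha | ⟨d, hd, h, hbody, c, hc, rfl⟩, i, hi⟩
  · exact hold x ⟨a, ha, i, hi⟩
  · have hdom (v : ℕ) (hv : d.IsFrontier v) : h v ∈ activeDom J := by
      obtain ⟨e, he, j, rfl⟩ := d.safe v hv
      exact ⟨_, hbody e he, j, rfl⟩
    change skSub d h (c.2 i) = x at hi
    cases hci : c.2 i with
    | inl v =>
      rw [hci] at hi
      subst hi
      exact hold _ (hdom v ⟨c, hc, i, hci⟩)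
    | inr z =>
      rw [hci] at hi
      subst hi
      exact ⟨hd, ⟨c, hc, i, hci⟩, fun v => hmono (hdom _ v.2)⟩

theorem closedInst_iterate (n : ℕ) : ClosedInst Γ I ((skStep Γ)^[n] (skBase I)) := by
  induction n with
  | zero => exact closedInst_skBase
  | succ n ih =>
    rw [Function.iterate_succ_apply']
    exact ih.skStep

theorem closedInst_SklCh : ClosedInst Γ I (SklCh Γ I) := by
  rintro x ⟨a, ha, i, hi⟩
  obtain ⟨n, hn⟩ := Set.mem_iUnion.1 ha
  have h := closedInst_iterate n x ⟨a, hn, i, hi⟩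
  cases x with
  | const c => exact h
  | sk d z xs => exact ⟨h.1, h.2.1, fun v => activeDom_mono (Set.subset_iUnion _ n) (h.2.2 v)⟩

theorem iterate_skStep_mono : Monotone fun n => (skStep Γ)^[n] (skBase I) := by
  refine monotone_nat_of_le_succ fun n => ?_
  rw [Function.iterate_succ_apply']
  exact Set.subset_union_left

variable (Γ I) in
/-- The instance represented after `n` rounds of equality saturation. -/
def stage : ℕ → DBInst RS rar (SkT RS rar C)
  | 0 => ∅
  | n + 1 => (skStep Γ)^[n] (skBase I)

theorem closedInst_stage : ∀ n, ClosedInst Γ I (stage Γ I n)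
  | 0 => fun _ ⟨_, ha, _⟩ => ha.elim
  | n + 1 => closedInst_iterate n

theorem stage_subset_SklCh : ∀ n, stage Γ I n ⊆ SklCh Γ I
  | 0 => Set.empty_subset _
  | n + 1 => Set.subset_iUnion (fun n => (skStep Γ)^[n] (skBase I)) n

variable (Γ I) in
/-- The `n`-th iterate of equality saturation. -/
def stageEG (n : ℕ) : EGraph (Sym Γ I) arity := instEG (stage Γ I n) (n ≠ 0) (closedInst_stage n)

theorem TRaut_ale_stageEG {n : ℕ} (hG : G.Le (stageEG Γ I n)) :
    ALe (TRaut (chaseTRS hΓ hI) G) (stageEG Γ I (n + 1)).toAutomaton := by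
  refine TRaut_ale_instAut (closedInst_stage n) (closedInst_stage (n + 1)) ?_ ?_ ?_
    n.succ_ne_zero hG
  · cases n with
    | zero => exact Set.empty_subset _
    | succ n => exact iterate_skStep_mono n.le_succ
  · exact iterate_skStep_mono n.zero_le
  · intro hn
    obtain ⟨n, rfl⟩ := Nat.exists_eq_succ_of_ne_zero hn
    exact (Function.iterate_succ_apply' (skStep Γ) n (skBase I)).ge

theorem stageEG_ale_of_TRaut {n : ℕ} (hG : (stageEG Γ I n).Le G)
    (hH : ALe (TRaut (chaseTRS hΓ hI) G) H.toAutomaton) : (stageEG Γ I (n + 1)).Le H := by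
  refine instAut_ale_of_TRaut (closedInst_stage n) ?_ hG hH
  cases n with
  | zero => exact Set.subset_union_left
  | succ n =>
    intro a ha
    exact .inr ⟨n.succ_ne_zero, (Function.iterate_succ_apply' (skStep Γ) n (skBase I)).le ha⟩

theorem stageEG_zero_le (h : ∃ c, H.toAutomaton.AcceptsG ttm c) : (stageEG Γ I 0).Le H := by
  obtain ⟨s, hs⟩ := h
  refine instAut_ale H s ?_
  rintro t (_ | h | ⟨a, ha⟩)
  · exact hs
  · exact (h rfl).elim
  · exact ha.elim

theorem isTermEG_stageEG_zero : IsTermEG ttm (stageEG Γ I 0) :=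
  ⟨⟨ttState _ _, acceptsG_ttState⟩, fun _ => stageEG_zero_le⟩

theorem iterSeq_stageEG : IterSeq (chaseTRS hΓ hI) (stageEG Γ I 0) (stageEG Γ I) :=
  ⟨rfl, fun _ => ⟨TRaut_ale_stageEG (ale_refl _), fun _ h => stageEG_ale_of_TRaut (ale_refl _) h⟩⟩

/-- Every sequence of iterates is equivalent to the sequence of stages. -/
theorem iterSeq_equiv {S : ℕ → EGraph (Sym Γ I) arity} (hG : IsTermEG ttm G)
    (hS : IterSeq (chaseTRS hΓ hI) G S) (n : ℕ) :
    (stageEG Γ I n).Le (S n) ∧ (S n).Le (stageEG Γ I n) := by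
  induction n with
  | zero =>
    rw [hS.1]
    exact ⟨stageEG_zero_le hG.1, hG.2 _ isTermEG_stageEG_zero.1⟩
  | succ n ih =>
    obtain ⟨h1, h2⟩ := hS.2 n
    exact ⟨stageEG_ale_of_TRaut ih.1 h1, h2 _ (TRaut_ale_stageEG ih.2)⟩

theorem acceptsG_of_le {t : Gd Γ I} (h : G.Le H) (ht : ∃ q, G.toAutomaton.AcceptsG t q) :
    ∃ q, H.toAutomaton.AcceptsG t q := by
  obtain ⟨g⟩ := h
  obtain ⟨q, hq⟩ := ht
  exact ⟨_, acceptsG_map g hq⟩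

theorem mem_SklCh_iff (hG : IsTermEG ttm G) (hH : IsEqSat (chaseTRS hΓ hI) G H)
    (a : DBAtom RS rar (SkT RS rar C)) :
    a ∈ SklCh Γ I ↔ ∃ q, H.toAutomaton.AcceptsG (encA Γ I a) q := by
  obtain ⟨S, hS, hub, hlub⟩ := hH
  constructor
  · intro ha
    obtain ⟨n, hn⟩ := Set.mem_iUnion.1 ha
    exact acceptsG_of_le (ale_trans (iterSeq_equiv hG hS (n + 1)).1 (hub (n + 1)))
      ((acceptsG_encA_iff (closedInst_stage (n + 1))).2 hn)
  · intro ha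
    have hle : H.Le (instEG (SklCh Γ I) True closedInst_SklCh) :=
      hlub _ fun i => ale_trans (iterSeq_equiv hG hS i).2
        ⟨instHom (stage_subset_SklCh i) fun _ => trivial⟩
    exact (acceptsG_encA_iff closedInst_SklCh).1 (acceptsG_of_le hle ha)

theorem instEG_iso (h : J = J') (hb : b ↔ b') (hJ : ClosedInst Γ I J) (hJ' : ClosedInst Γ I J') :
    (instEG J b hJ).Iso (instEG J' b' hJ') :=
  ⟨instHom h.le hb.1, instHom h.ge hb.2, fun _ => rfl, fun _ => rfl⟩

theorem terminates_iff : SklChTerminates Γ I ↔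
    ∃ G : EGraph (Sym Γ I) arity, IsTermEG ttm G ∧ EqSatTerminates (chaseTRS hΓ hI) G := by
  constructor
  · rintro ⟨n, hn⟩
    refine ⟨_, isTermEG_stageEG_zero, _, iterSeq_stageEG, n + 1, fun m hm => ?_⟩
    obtain ⟨k, rfl⟩ := Nat.exists_eq_add_of_le hm
    refine instEG_iso ?_ (by simp) _ _
    rw [show n + 1 + k = (k + n) + 1 by omega]
    change (skStep Γ)^[k + n] (skBase I) = (skStep Γ)^[n] (skBase I)
    rw [Function.iterate_succ_apply'] at hn
    rw [Function.iterate_add_apply]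
    exact Function.iterate_fixed hn k
  · rintro ⟨G, hG, S, hS, n, hn⟩
    refine ⟨n, (Set.Subset.antisymm ?_ (iterate_skStep_mono n.le_succ))⟩
    intro a ha
    obtain ⟨g, -⟩ := hn (n + 2) (by omega)
    have hle : (stageEG Γ I (n + 2)).Le (stageEG Γ I n) :=
      ale_trans (iterSeq_equiv hG hS (n + 2)).1 (ale_trans ⟨g⟩ (iterSeq_equiv hG hS n).2)
    have h := (acceptsG_encA_iff (closedInst_stage n)).1
      (acceptsG_of_le hle ((acceptsG_encA_iff (closedInst_stage (n + 2))).2 ha))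
    cases n with
    | zero => exact h.elim
    | succ n => exact iterate_skStep_mono n.le_succ h

end Encoding

end EqSatReduction

/-- Reduction of the Skolem chase to equality saturation.  Given a schema, a finite set
`Γ` of TGDs and a finite initial instance `I`, there are a finite signature, a TRS `R`
and a ground term `t` such that `ξ(EqSat(R, t)) = SklCh(Γ, I)` — where, under an
injective encoding of relation symbols as function symbols and of Skolem-term domain
elements as ground terms, a database atom belongs to the Skolem chase result iff its
encoding as a term `R(c₁,…,cₖ)` is represented by the E-graph `EqSat(R, t)` — and
moreover the Skolem chase terminates iff equality saturation terminates. -/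
theorem skolem_chase_to_eqsat {RS : Type} {rar : RS → ℕ} [Finite RS] {C : Type}
    (Γ : Set (TGDep RS rar)) (hΓ : Γ.Finite) (I : DBInst RS rar C) (hI : I.Finite) :
    ∃ (F : Type) (ar : F → ℕ), Finite F ∧
      ∃ (R : TRS F ar) (t : GTm F ar) (encR : RS → F)
        (harity : ∀ Rn : RS, ar (encR Rn) = rar Rn) (encD : SkT RS rar C → GTm F ar),
        Function.Injective encR ∧
        Set.InjOn encD { x | ∃ a ∈ SklCh Γ I, ∃ i, a.2 i = x } ∧
        (∀ H : EGraph F ar, (∃ G0 : EGraph F ar, IsTermEG t G0 ∧ IsEqSat R G0 H) →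
          ∀ a : DBAtom RS rar (SkT RS rar C),
            (a ∈ SklCh Γ I ↔
              ∃ q : H.Q, H.toAutomaton.AcceptsG
                (Tm.node (encR a.1) fun i => encD (a.2 (Fin.cast (harity a.1) i))) q)) ∧
        (SklChTerminates Γ I ↔ ∃ G0 : EGraph F ar, IsTermEG t G0 ∧ EqSatTerminates R G0) := by
  exact ⟨EqSatReduction.Sym Γ I, EqSatReduction.arity, EqSatReduction.finite_sym hΓ hI,
    EqSatReduction.chaseTRS hΓ hI, EqSatReduction.ttm, .rel, fun _ => rfl, EqSatReduction.enc Γ I,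
    fun _ _ h => by injection h,
    fun _ hx _ _ h =>
      EqSatReduction.enc_injective_of_closed EqSatReduction.closedInst_SklCh hx h,
    fun _ ⟨_, hG, hH⟩ => EqSatReduction.mem_SklCh_iff hG hH, EqSatReduction.terminates_iff⟩
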